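/- Let (S, 𝔪) be a regular local ring containing a field, I an ideal of S with d = dim(S/I), and suppose the local cohomology module H^j_I(S) is nonzero if and only if j = ht(I) (i.e., I is a cohomologically complete intersection). Then the Lyubeznik numbers of R = S/I satisfy λ_{i,j}(R) = 1 if i = j = d and λ_{i,j}(R) = 0 otherwise. -/

import Mathlib

set_option synthInstance.maxHeartbeats 1000000
set_option maxHeartbeats 1000000

open CategoryTheory Opposite IsLocalRing

namespace LyuAux

universe u

section Comparison

variable {R : Type u} [CommRing R] {X : ModuleCat.{u} R} (P : ProjectiveResolution X)
  (Y : ModuleCat.{u} R) (n : ℕ)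

/-- underlying map of an `n`-cocycle -/
noncomputable def cocyc (z : (P.complex.linearYonedaObj R Y).cycles n) : P.complex.X n ⟶ Y :=
  ((P.complex.linearYonedaObj R Y).iCycles n z :)

lemma cocyc_d (z : (P.complex.linearYonedaObj R Y).cycles n) :
    P.complex.d (n+1) n ≫ cocyc P Y n z = 0 := by
  have := ConcreteCategory.congr_hom
    ((P.complex.linearYonedaObj R Y).iCycles_d n (n+1)) z
  exact this

lemma cocyc_surj (f : P.complex.X n ⟶ Y) (hf : P.complex.d (n+1) n ≫ f = 0) :
    ∃ z, cocyc P Y n z = f := by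
  let k : ModuleCat.of R R ⟶ (P.complex.linearYonedaObj R Y).X n :=
    ModuleCat.ofHom (LinearMap.toSpanSingleton R (P.complex.X n ⟶ Y) f)
  have hk : k ≫ (P.complex.linearYonedaObj R Y).d n (n+1) = 0 := by
    ext
    simp only [ModuleCat.hom_comp, LinearMap.comp_apply]
    change P.complex.d (n+1) n ≫ ((1 : R) • f) = 0
    simp [hf]
  refine ⟨(P.complex.linearYonedaObj R Y).liftCycles k (n+1) (by simp) hk (1 : R), ?_⟩
  have := ConcreteCategory.congr_hom
    ((P.complex.linearYonedaObj R Y).liftCycles_i k (n+1) (by simp) hk) (1 : R)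
  refine Eq.trans this ?_
  change (1 : R) • f = f
  simp

noncomputable def cycToExt : (P.complex.linearYonedaObj R Y).cycles n ⟶
    ModuleCat.of R (Abelian.Ext.{u} X Y n) :=
  ModuleCat.ofHom
    { toFun z := P.extMk (cocyc P Y n z) (n+1) rfl (cocyc_d P Y n z)
      map_add' x y := by
        rw [P.add_extMk]
        congr 1
        exact map_add ((P.complex.linearYonedaObj R Y).iCycles n).hom x y
      map_smul' r x := by
        rw [Abelian.Ext.smul_eq_comp_mk₀, RingHom.id_apply, P.extMk_comp_mk₀]
        congr 1
        simp only [Linear.comp_smul, Category.comp_id]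
        exact map_smul ((P.complex.linearYonedaObj R Y).iCycles n).hom r x }

lemma cycToExt_apply (z) : cycToExt P Y n z = P.extMk (cocyc P Y n z) (n+1) rfl (cocyc_d P Y n z) :=
  rfl

lemma cocyc_inj {z w} (h : cocyc P Y n z = cocyc P Y n w) : z = w := by
  have : Mono ((P.complex.linearYonedaObj R Y).iCycles n) := inferInstance
  rw [ModuleCat.mono_iff_injective] at this
  exact this h

open CochainComplex HomComplex in
lemma extMk_zero_eq_zero (f : P.complex.X 0 ⟶ Y) (hf : P.complex.d 1 0 ≫ f = 0)
    (h : P.extMk f 1 rfl hf = 0) : f = 0 := by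
  simp only [← P.extEquivCohomologyClass.apply_eq_iff_eq,
    P.extEquivCohomologyClass_extMk, P.extEquivCohomologyClass_zero,
    CohomologyClass.mk_eq_zero_iff] at h
  rw [Cocycle.toSingleMk_mem_coboundaries_iff _ _ _ _ _ (1) (by simp)] at h
  obtain ⟨g, hg⟩ := h
  have h0 : Limits.IsZero (P.cochainComplex.X 1) :=
    CochainComplex.isZero_of_isStrictlyLE _ 0 1 (by simp)
  rw [h0.eq_of_src g 0, Limits.comp_zero] at hg
  rw [← cancel_epi (P.cochainComplexXIso (-(0:ℕ)) 0 rfl).hom]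
  simpa using hg.symm

lemma toCycles_cocyc (p : ℕ) (g : P.complex.X p ⟶ Y) :
    cocyc P Y (n) ((P.complex.linearYonedaObj R Y).toCycles p n g) = P.complex.d n p ≫ g := by
  exact ConcreteCategory.congr_hom ((P.complex.linearYonedaObj R Y).toCycles_i p n) g

lemma toCycles_cycToExt (p : ℕ) (hp : (ComplexShape.up ℕ).prev n = p) :
    (P.complex.linearYonedaObj R Y).toCycles p n ≫ cycToExt P Y n = 0 := by
  by_cases h : (ComplexShape.up ℕ).Rel p n
  · ext g
    have h' : p + 1 = n := h
    exact (P.extMk_eq_zero_iff _ _ rfl (cocyc_d P Y n _) p h').mpr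
      ⟨g, (toCycles_cocyc P Y n p g).symm⟩
  · rw [HomologicalComplex.toCycles_eq_zero _ h, Limits.zero_comp]

lemma cycToExt_surj : Function.Surjective (cycToExt P Y n) := by
  intro x
  obtain ⟨f, hf, rfl⟩ := P.extMk_surjective x (n+1) rfl
  obtain ⟨z, rfl⟩ := cocyc_surj P Y n f hf
  exact ⟨z, rfl⟩

lemma cycToExt_ker (z) (hz : cycToExt P Y n z = 0) :
    (P.complex.linearYonedaObj R Y).homologyπ n z = 0 := by
  rw [cycToExt_apply] at hz
  cases n with
  | zero =>
    have := extMk_zero_eq_zero P Y _ _ hz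
    have hz : z = 0 := cocyc_inj P Y 0 (this.trans
      (map_zero ((P.complex.linearYonedaObj R Y).iCycles 0).hom).symm)
    rw [hz]
    exact map_zero ((P.complex.linearYonedaObj R Y).homologyπ 0).hom
  | succ n =>
    rw [P.extMk_eq_zero_iff _ _ _ _ n rfl] at hz
    obtain ⟨g, hg⟩ := hz
    rw [← toCycles_cocyc] at hg
    rw [← cocyc_inj P Y _ hg]
    exact ConcreteCategory.congr_hom
      ((P.complex.linearYonedaObj R Y).toCycles_comp_homologyπ n (n+1)) g

noncomputable def homToExt : (P.complex.linearYonedaObj R Y).homology n ⟶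
    ModuleCat.of R (Abelian.Ext.{u} X Y n) :=
  ((P.complex.linearYonedaObj R Y).homologyIsCokernel _ n rfl).desc
    (Limits.CokernelCofork.ofπ (cycToExt P Y n) (toCycles_cycToExt P Y n _ rfl))

lemma π_homToExt : (P.complex.linearYonedaObj R Y).homologyπ n ≫ homToExt P Y n =
    cycToExt P Y n :=
  ((P.complex.linearYonedaObj R Y).homologyIsCokernel _ n rfl).fac
    (Limits.CokernelCofork.ofπ (cycToExt P Y n) (toCycles_cycToExt P Y n _ rfl))
      Limits.WalkingParallelPair.one

lemma π_surj : Function.Surjective ((P.complex.linearYonedaObj R Y).homologyπ n) := by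
  rw [← ModuleCat.epi_iff_surjective]
  infer_instance

lemma homToExt_π_apply (z) : homToExt P Y n ((P.complex.linearYonedaObj R Y).homologyπ n z) =
    cycToExt P Y n z :=
  ConcreteCategory.congr_hom (π_homToExt P Y n) z

instance : IsIso (homToExt P Y n) := by
  have : Mono (homToExt P Y n) := by
    rw [ModuleCat.mono_iff_injective]
    refine (injective_iff_map_eq_zero (homToExt P Y n).hom).mpr ?_
    intro x hx
    obtain ⟨z, rfl⟩ := π_surj P Y n x
    exact cycToExt_ker P Y n z ((homToExt_π_apply P Y n z).symm.trans hx)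
  have : Epi (homToExt P Y n) := by
    rw [ModuleCat.epi_iff_surjective]
    intro x
    obtain ⟨z, rfl⟩ := cycToExt_surj P Y n x
    exact ⟨_, homToExt_π_apply P Y n z⟩
  exact isIso_of_mono_of_epi _


variable {X' : ModuleCat.{u} R} {P' : ProjectiveResolution X'} {f : X ⟶ X'}
variable {P} (φ : ProjectiveResolution.Hom P P' f)

/-- Map induced on Hom complexes by a morphism of resolutions. -/
noncomputable def lyMap : P'.complex.linearYonedaObj R Y ⟶ P.complex.linearYonedaObj R Y :=
  (HomologicalComplex.unopFunctor _ _).map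
    ((((linearYoneda R (ModuleCat.{u} R)).obj Y).rightOp.mapHomologicalComplex _).map φ.hom).op

lemma lyMap_cocyc (z) : cocyc P Y n (HomologicalComplex.cyclesMap (lyMap Y φ) n z) =
    φ.hom.f n ≫ cocyc P' Y n z := by
  exact ConcreteCategory.congr_hom (HomologicalComplex.cyclesMap_i (lyMap Y φ) n) z

/-- precomposition on Ext as a morphism of modules -/
noncomputable def preHom (f : X ⟶ X') : ModuleCat.of R (Abelian.Ext.{u} X' Y n) ⟶
    ModuleCat.of R (Abelian.Ext.{u} X Y n) :=
  ModuleCat.ofHom ((Abelian.Ext.mk₀ f).precompOfLinear R Y (zero_add n))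

lemma cycToExt_naturality : HomologicalComplex.cyclesMap (lyMap Y φ) n ≫ cycToExt P Y n =
    cycToExt P' Y n ≫ preHom Y n f := by
  ext z
  change P.extMk (cocyc P Y n (HomologicalComplex.cyclesMap (lyMap Y φ) n z)) (n+1) rfl
    (cocyc_d P Y n _) =
    (Abelian.Ext.mk₀ f).comp (P'.extMk (cocyc P' Y n z) (n+1) rfl (cocyc_d P' Y n z)) (zero_add n)
  rw [ProjectiveResolution.mk₀_comp_extMk _ _ _ _ φ]
  congr 1
  exact lyMap_cocyc Y n φ z

lemma homToExt_naturality : HomologicalComplex.homologyMap (lyMap Y φ) n ≫ homToExt P Y n =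
    homToExt P' Y n ≫ preHom Y n f := by
  rw [← cancel_epi ((P'.complex.linearYonedaObj R Y).homologyπ n),
    HomologicalComplex.homologyπ_naturality_assoc, π_homToExt, cycToExt_naturality,
    ← Category.assoc, π_homToExt]

lemma sq_inv {C : Type*} [Category C] {A B A' B' : C} (a : A ⟶ A') (e' : A' ≅ B')
    (e : A ≅ B) (b : B ⟶ B') (h : a ≫ e'.hom = e.hom ≫ b) : e.inv ≫ a = b ≫ e'.inv := by
  rw [Iso.inv_comp_eq, ← Category.assoc, ← h, Category.assoc, Iso.hom_inv_id, Category.comp_id]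

lemma glue_sq {C : Type*} [Category C] {A B D A' B' D' : C} {a : A ⟶ A'} {b : B ⟶ B'}
    {d : D ⟶ D'} {p : A' ⟶ B'} {p' : A ⟶ B} {q : B' ⟶ D'} {q' : B ⟶ D}
    (h : a ≫ p = p' ≫ b) (h' : b ≫ q = q' ≫ d) : a ≫ p ≫ q = (p' ≫ q') ≫ d := by
  rw [← Category.assoc, h, Category.assoc, h', Category.assoc]

lemma isoExt_naturality :
    ((Ext R (ModuleCat.{u} R) n).map f.op).app Y ≫ (P.isoExt n Y).hom =
      (P'.isoExt (R := R) n Y).hom ≫ HomologicalComplex.homologyMap (lyMap Y φ) n := by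
  have h1 := ProjectiveResolution.isoLeftDerivedObj_hom_naturality f P P' φ.hom
    (by simpa using φ.hom_f_zero_comp_π_f_zero)
    ((linearYoneda R (ModuleCat.{u} R)).obj Y).rightOp n
  have h2 := HomologicalComplex.homologyOp_hom_naturality (lyMap Y φ) n
  have h1' := congrArg Quiver.Hom.unop (sq_inv _ _ _ _ h1)
  have h2' := congrArg Quiver.Hom.unop (sq_inv _ _ _ _ h2)
  exact glue_sq h1' h2'

end Comparison

/-- Comparison of the two versions of Ext. -/
noncomputable def extIso {R : Type u} [CommRing R] (X Y : ModuleCat.{u} R) (n : ℕ) :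
    ((Ext R (ModuleCat.{u} R) n).obj (op X)).obj Y ≅ ModuleCat.of R (Abelian.Ext.{u} X Y n) :=
  (projectiveResolution X).isoExt n Y ≪≫ asIso (homToExt (projectiveResolution X) Y n)

lemma extIso_naturality {R : Type u} [CommRing R] {X X' : ModuleCat.{u} R} (f : X ⟶ X')
    (Y : ModuleCat.{u} R) (n : ℕ) :
    ((Ext R (ModuleCat.{u} R) n).map f.op).app Y ≫ (extIso X Y n).hom =
      (extIso X' Y n).hom ≫ preHom Y n f := by
  let φ : ProjectiveResolution.Hom (projectiveResolution X) (projectiveResolution X') f :=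
    { hom := ProjectiveResolution.lift f _ _
      hom_f_zero_comp_π_f_zero := by
        simpa using ProjectiveResolution.lift_commutes_zero f _ _ }
  simp only [extIso, Iso.trans_hom, asIso_hom]
  rw [← Category.assoc, isoExt_naturality Y n φ, Category.assoc, homToExt_naturality,
    Category.assoc]

end LyuAux

namespace LyuAux

section RegularDomain

lemma exists_prime_dim {R : Type*} [CommRing R] (n : ℕ) (h : ringKrullDim R = n) :
    ∃ q : PrimeSpectrum R, (n : WithBot ℕ∞) ≤ ringKrullDim (R ⧸ q.asIdeal) := by
  obtain ⟨p, hp⟩ := Order.le_krullDim_iff.mp h.ge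
  refine ⟨p.head, ?_⟩
  rw [ringKrullDim_quotient]
  refine Order.le_krullDim_iff.mpr ⟨⟨p.length, fun i => ⟨p i, ?_⟩, ?_⟩, hp⟩
  · rw [PrimeSpectrum.mem_zeroLocus]
    exact p.monotone (Fin.zero_le i)
  · intro i
    exact p.step i

lemma dim_le_quot_add_one {R : Type*} [CommRing R] [IsNoetherianRing R] [IsLocalRing R] (x : R)
    (hx : x ∈ maximalIdeal R) : ringKrullDim R ≤ ringKrullDim (R ⧸ Ideal.span {x}) + 1 := by
  have h1 := ringKrullDim_le_ringKrullDim_quotient_add_card ({x} : Finset R)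
    (by simpa [IsLocalRing.ringJacobson_eq_maximalIdeal] using hx)
  simp only [Finset.card_singleton, Nat.cast_one] at h1
  have e := ringKrullDim_eq_of_ringEquiv (Ideal.quotEquivOfEq
    (by simp : Ideal.span ((({x} : Finset R) : Set R)) = Ideal.span {x}))
  rwa [e] at h1

lemma exists_nat_of_le {z : WithBot ℕ∞} {n : ℕ} (h0 : 0 ≤ z) (h : z ≤ n) : ∃ k : ℕ, z = k := by
  induction z with
  | bot => simp at h0
  | coe z =>
    induction z with
    | top =>
      have h' : (⊤ : ℕ∞) ≤ n := by exact_mod_cast h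
      exact absurd h' (by simp)
    | coe z => exact ⟨z, rfl⟩

lemma domain_of_bot {R : Type*} [CommRing R] (h : (⊥ : Ideal R).IsPrime) : IsDomain R :=
  (RingEquiv.quotientBot R).symm.toMulEquiv.isDomain (R ⧸ (⊥ : Ideal R))

lemma domain_step {R : Type*} [CommRing R] [IsNoetherianRing R] [IsLocalRing R] (n : ℕ) (x : R)
    (hx : x ∈ maximalIdeal R) (hR : ringKrullDim R = (n + 1 : ℕ))
    (hRx : ringKrullDim (R ⧸ Ideal.span {x}) = n)
    [IsDomain (R ⧸ Ideal.span {x})] : IsDomain R ∧ x ≠ 0 := by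
  have hx0 : x ≠ 0 := by
    rintro rfl
    have e := ringKrullDim_eq_of_ringEquiv
      ((Ideal.quotEquivOfEq (by simp : Ideal.span {(0 : R)} = ⊥)).trans
        (RingEquiv.quotientBot R))
    rw [hRx, hR] at e
    norm_cast at e
    omega
  refine ⟨?_, hx0⟩
  obtain ⟨q, hq⟩ := exists_prime_dim (n + 1) hR
  -- dim R/(q + x) ≥ n
  have hxq : x ∉ q.asIdeal := by
    intro hmem
    have h1 : Ideal.span {x} ≤ q.asIdeal := by simpa [Ideal.span_le] using hmem
    have := ringKrullDim_le_of_surjective (Ideal.Quotient.factor h1)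
      (Ideal.Quotient.factor_surjective h1)
    rw [hRx] at this
    have := hq.trans this
    norm_cast at this
    omega
  have hle : q.asIdeal ≤ Ideal.span {x} := by
    by_contra hcon
    obtain ⟨y, hy, hyx⟩ := SetLike.not_le_iff_exists.mp hcon
    let A := R ⧸ q.asIdeal
    let xb : A := Ideal.Quotient.mk _ x
    have hloc : IsLocalRing A := IsLocalRing.of_surjective' (Ideal.Quotient.mk q.asIdeal)
      Ideal.Quotient.mk_surjective
    have hxb : xb ∈ maximalIdeal A := by
      rw [← IsLocalRing.map_maximalIdeal_of_surjective (Ideal.Quotient.mk q.asIdeal)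
        Ideal.Quotient.mk_surjective]
      exact Ideal.mem_map_of_mem _ hx
    have h1 := dim_le_quot_add_one xb hxb
    let f : (R ⧸ Ideal.span {x}) →+* (A ⧸ Ideal.span {xb}) :=
      Ideal.Quotient.lift _ ((Ideal.Quotient.mk (Ideal.span {xb})).comp (Ideal.Quotient.mk q.asIdeal))
        (by
          intro a ha
          obtain ⟨b, rfl⟩ := Ideal.mem_span_singleton'.mp ha
          simp only [RingHom.comp_apply, map_mul]
          rw [Ideal.Quotient.eq_zero_iff_mem.mpr (Ideal.mem_span_singleton_self xb), mul_zero])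
    have hf : Function.Surjective f := by
      apply Ideal.Quotient.lift_surjective_of_surjective
      exact Ideal.Quotient.mk_surjective.comp Ideal.Quotient.mk_surjective
    have h2 := ringKrullDim_succ_le_of_surjective f hf
      (r := Ideal.Quotient.mk _ y) (mem_nonZeroDivisors_of_ne_zero (by
        rwa [Ne, Ideal.Quotient.eq_zero_iff_mem])) (by
        simp only [f, Ideal.Quotient.lift_mk, RingHom.comp_apply]
        rw [Ideal.Quotient.eq_zero_iff_mem.mpr hy, map_zero])
    rw [hRx] at h2
    have h3 := (hq.trans h1).trans h2
    norm_cast at h3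
    omega
  have hq0 : q.asIdeal = ⊥ := by
    refine Submodule.eq_bot_of_le_smul_of_le_jacobson_bot (Ideal.span {x}) _
      (IsNoetherian.noetherian _) ?_ ?_
    · intro y hy
      obtain ⟨b, rfl⟩ := Ideal.mem_span_singleton'.mp (hle hy)
      have hb : b ∈ q.asIdeal := (q.isPrime.mem_or_mem hy).resolve_right hxq
      rw [mul_comm]
      exact Submodule.smul_mem_smul (Ideal.mem_span_singleton_self x) hb
    · rw [IsLocalRing.jacobson_eq_maximalIdeal ⊥ bot_ne_top]
      simpa [Ideal.span_le] using hx
  have := q.isPrime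
  rw [hq0] at this
  exact domain_of_bot this

open RingTheory.Sequence in
lemma regular_list (n : ℕ) : ∀ {R : Type*} [CommRing R] [IsNoetherianRing R] [IsLocalRing R]
    (l : List R), l.length = n → Ideal.ofList l = maximalIdeal R → ringKrullDim R = n →
    IsDomain R ∧ IsWeaklyRegular R l := by
  induction n with
  | zero =>
    intro R _ _ _ l hl hm hd
    obtain rfl := List.length_eq_zero_iff.mp hl
    rw [Ideal.ofList_nil] at hm
    refine ⟨?_, IsWeaklyRegular.nil _ _⟩
    have : (⊥ : Ideal R).IsPrime := hm ▸ (maximalIdeal.isMaximal R).isPrime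
    exact domain_of_bot this
  | succ n ih =>
    intro R _ _ _ l hl hm hd
    obtain ⟨x, l, rfl⟩ := List.exists_cons_of_length_eq_add_one hl
    have hxm : x ∈ maximalIdeal R := hm ▸ Ideal.subset_span (by simp)
    have hnt : Nontrivial (R ⧸ Ideal.span {x}) := Ideal.Quotient.nontrivial_iff.mpr (by
      rw [Ne, Ideal.span_singleton_eq_top]
      exact (IsLocalRing.mem_maximalIdeal x).mp hxm)
    have hloc : IsLocalRing (R ⧸ Ideal.span {x}) :=
      IsLocalRing.of_surjective' (Ideal.Quotient.mk _) Ideal.Quotient.mk_surjective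
    let l' := l.map (Ideal.Quotient.mk (Ideal.span {x}))
    have hm' : Ideal.ofList l' = maximalIdeal (R ⧸ Ideal.span {x}) := by
      rw [← IsLocalRing.map_maximalIdeal_of_surjective (Ideal.Quotient.mk (Ideal.span {x}))
        Ideal.Quotient.mk_surjective, ← hm, Ideal.map_ofList, List.map_cons, Ideal.ofList_cons,
        Ideal.Quotient.eq_zero_iff_mem.mpr (Ideal.mem_span_singleton_self x)]
      simp [l']
    have hl' : l'.length = n := by simpa [l'] using hl
    have hd' : ringKrullDim (R ⧸ Ideal.span {x}) = n := by
      have h1 := dim_le_quot_add_one x hxm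
      have h2 := ringKrullDim_le_spanFinrank_maximalIdeal (R ⧸ Ideal.span {x})
      have h3 : (maximalIdeal (R ⧸ Ideal.span {x})).spanFinrank ≤ n := by
        rw [← hm', ← hl']
        classical
        have e : (Ideal.ofList l') = Submodule.span _ (l'.toFinset : Set (R ⧸ Ideal.span {x})) := by
          simp [Ideal.ofList]
        rw [e]
        refine (Submodule.spanFinrank_span_le_ncard_of_finite (Finset.finite_toSet _)).trans ?_
        rw [Set.ncard_coe_finset]
        exact List.toFinset_card_le _
      have h4 : ringKrullDim (R ⧸ Ideal.span {x}) ≤ n := h2.trans (by exact_mod_cast h3)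
      refine le_antisymm h4 ?_
      rw [hd] at h1
      have h5 := h1
      obtain ⟨k, hk⟩ := exists_nat_of_le
        (ringKrullDim_nonneg_of_nontrivial (R := R ⧸ Ideal.span {x})) h4
      rw [hk] at h5 ⊢
      norm_cast at h5 ⊢
      omega
    obtain ⟨hdom, hreg⟩ := ih l' hl' hm' hd'
    obtain ⟨hdR, hx0⟩ := domain_step n x hxm hd hd'
    refine ⟨hdR, ?_⟩
    rw [isWeaklyRegular_cons_iff]
    refine ⟨IsSMulRegular.of_ne_zero hx0, ?_⟩
    have h6 := (isWeaklyRegular_map_algebraMap_iff (R ⧸ Ideal.span {x}) (R ⧸ Ideal.span {x}) l).mp hreg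
    have e : QuotSMulTop x R ≃ₗ[R] (R ⧸ Ideal.span {x}) :=
      Submodule.quotEquivOfEq _ _ (by
        rw [← Submodule.ideal_span_singleton_smul]; simp)
    exact (e.isWeaklyRegular_congr l).mpr h6

end RegularDomain
end LyuAux

namespace LyuAux
universe u
section ExtBasics

open Abelian (Ext)
open Abelian.Ext
open scoped Pointwise

variable {R : Type u} [CommRing R]

/-- Ext is invariant under isomorphism in the first variable. -/
noncomputable def extCongrLeft {X X' : ModuleCat.{u} R} (e : X ≅ X') (Y : ModuleCat.{u} R) (n : ℕ) :
    Abelian.Ext.{u} X Y n ≃ₗ[R] Abelian.Ext.{u} X' Y n :=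
  LinearEquiv.ofLinearMap ((mk₀ e.inv).precompOfLinear R Y (zero_add n))
    ((mk₀ e.hom).precompOfLinear R Y (zero_add n))
    (by ext x; simp [precompOfLinear]) (by ext x; simp [precompOfLinear])

/-- Ext is invariant under isomorphism in the second variable. -/
noncomputable def extCongrRight (X : ModuleCat.{u} R) {Y Y' : ModuleCat.{u} R} (e : Y ≅ Y') (n : ℕ) :
    Abelian.Ext.{u} X Y n ≃ₗ[R] Abelian.Ext.{u} X Y' n :=
  LinearEquiv.ofLinearMap ((mk₀ e.hom).postcompOfLinear R X (add_zero n))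
    ((mk₀ e.inv).postcompOfLinear R X (add_zero n))
    (by ext x; simp [postcompOfLinear]) (by ext x; simp [postcompOfLinear])

lemma ext_subsingleton_of_subsingleton_right (X Y : ModuleCat.{u} R) [Subsingleton Y] (n : ℕ) :
    Subsingleton (Abelian.Ext.{u} X Y n) := by
  refine subsingleton_of_forall_eq 0 fun x => ?_
  have h : 𝟙 Y = 0 := by ext y; exact Subsingleton.elim _ _
  rw [← x.comp_mk₀_id, h]
  simp

section smulSES

variable {M Q : ModuleCat.{u} R} {r : R} {g : M ⟶ Q} {w : (r • 𝟙 M) ≫ g = 0}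

lemma smulf_comp (Y : ModuleCat.{u} R) (n : ℕ) (x : Abelian.Ext.{u} M Y n) :
    (mk₀ (r • 𝟙 M)).comp x (zero_add n) = r • x := by
  rw [mk₀_smul, smul_comp, mk₀_id_comp]

lemma ext_quot_succ_subsingleton
    (hS : (ShortComplex.mk (r • 𝟙 M) g w).ShortExact) (Y : ModuleCat.{u} R) (n : ℕ)
    (h1 : ∀ x : Abelian.Ext.{u} M Y n, ∃ y, r • y = x)
    (h2 : ∀ x : Abelian.Ext.{u} M Y (n + 1), r • x = 0 → x = 0) :
    Subsingleton (Abelian.Ext.{u} Q Y (n + 1)) := by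
  refine subsingleton_of_forall_eq 0 fun z => ?_
  have hz : (mk₀ g).comp z (zero_add (n + 1)) = 0 := by
    apply h2
    rw [← smulf_comp Y, mk₀_comp_mk₀_assoc, w]
    simp
  obtain ⟨y, hy⟩ := contravariant_sequence_exact₃ hS Y z hz (add_comm 1 n)
  dsimp at y
  obtain ⟨w, hw⟩ := h1 y
  refine hy.symm.trans ?_
  rw [← hw, ← smulf_comp Y]
  exact hS.extClass_comp_assoc w

lemma ext_quot_zero_subsingleton
    (hS : (ShortComplex.mk (r • 𝟙 M) g w).ShortExact) (Y : ModuleCat.{u} R)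
    (h2 : ∀ x : Abelian.Ext.{u} M Y 0, r • x = 0 → x = 0) :
    Subsingleton (Abelian.Ext.{u} Q Y 0) := by
  refine subsingleton_of_forall_eq 0 fun z => ?_
  have hz : (mk₀ g).comp z (zero_add 0) = 0 := by
    apply h2
    rw [← smulf_comp Y, mk₀_comp_mk₀_assoc, w]
    simp
  have : Epi g := hS.epi_g
  apply precomp_mk₀_injective_of_epi Y g
  simpa using hz

/-- If `r` is surjective on `Ext^n(Q,Y)` and ... -/
lemma smul_surj_of_quot_subsingleton
    (hS : (ShortComplex.mk (r • 𝟙 M) g w).ShortExact) (Y : ModuleCat.{u} R) (n : ℕ) [Subsingleton (Abelian.Ext.{u} Q Y (n + 1))]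
    (x : Abelian.Ext.{u} M Y n) : ∃ y, r • y = x := by
  obtain ⟨y, hy⟩ := contravariant_sequence_exact₁ hS Y x (add_comm 1 n)
    (Subsingleton.elim (α := Abelian.Ext.{u} Q Y (n + 1)) _ _)
  exact ⟨y, (smulf_comp Y n y).symm.trans hy⟩

lemma ext_quot_equiv
    (hS : (ShortComplex.mk (r • 𝟙 M) g w).ShortExact) (Y : ModuleCat.{u} R) (n : ℕ) [Subsingleton (Abelian.Ext.{u} M Y (n + 1))] :
    Nonempty (Abelian.Ext.{u} Q Y (n + 1) ≃ₗ[R] QuotSMulTop r (Abelian.Ext.{u} M Y n)) := by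
  let φ : Abelian.Ext.{u} M Y n →ₗ[R] Abelian.Ext.{u} Q Y (n + 1) :=
    hS.extClass.precompOfLinear R Y (add_comm 1 n)
  have hφ : Function.Surjective φ := by
    intro z
    obtain ⟨y, hy⟩ := contravariant_sequence_exact₃ hS Y z (Subsingleton.elim (α := Abelian.Ext.{u} M Y (n + 1)) _ _)
      (add_comm 1 n)
    exact ⟨y, hy⟩
  have hk : LinearMap.ker φ = r • (⊤ : Submodule R (Abelian.Ext.{u} M Y n)) := by
    ext x
    rw [LinearMap.mem_ker, Submodule.mem_smul_pointwise_iff_exists]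
    constructor
    · intro hx
      obtain ⟨y, hy⟩ := contravariant_sequence_exact₁ hS Y x (add_comm 1 n) hx
      exact ⟨y, trivial, (smulf_comp Y n y).symm.trans hy⟩
    · rintro ⟨y, -, rfl⟩
      rw [← smulf_comp Y]
      exact hS.extClass_comp_assoc y (h := add_comm 1 n)
  exact ⟨((Submodule.quotEquivOfEq _ _ hk.symm).trans (φ.quotKerEquivOfSurjective hφ)).symm⟩

end smulSES

lemma smul_shortExact (M : ModuleCat.{u} R) (r : R) (hr : IsSMulRegular M r) :
    ∃ (w : (r • 𝟙 M) ≫ ModuleCat.ofHom (Submodule.mkQ (r • (⊤ : Submodule R M))) = 0),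
      (ShortComplex.mk (r • 𝟙 M) (ModuleCat.ofHom (Submodule.mkQ (r • (⊤ : Submodule R M)))) w).ShortExact :=
  ⟨(M.smulShortComplex r).zero, hr.smulShortComplex_shortExact⟩

/-- `Ext^i(A,Y)` is concentrated in degree `k`, where it is isomorphic to `A`. -/
def Conc (Y : ModuleCat.{u} R) (A : Type u) [AddCommGroup A] [Module R A] (k : ℕ) : Prop :=
  (∀ i, i ≠ k → Subsingleton (Abelian.Ext.{u} (ModuleCat.of R A) Y i)) ∧
    Nonempty (Abelian.Ext.{u} (ModuleCat.of R A) Y k ≃ₗ[R] A)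

lemma Conc.congr {Y : ModuleCat.{u} R} {A B : Type u} [AddCommGroup A] [Module R A]
    [AddCommGroup B] [Module R B] {k : ℕ} (h : Conc Y A k) (e : A ≃ₗ[R] B) : Conc Y B k := by
  refine ⟨fun i hi => ?_, ?_⟩
  · have := h.1 i hi
    exact (extCongrLeft e.toModuleIso Y i).symm.toEquiv.subsingleton
  · exact h.2.map fun f => ((extCongrLeft e.toModuleIso Y k).symm.trans f).trans e

lemma Conc.quot {Y : ModuleCat.{u} R} {A : Type u} [AddCommGroup A] [Module R A] {k : ℕ}
    (h : Conc Y A k) {r : R} (hr : IsSMulRegular A r) : Conc Y (QuotSMulTop r A) (k + 1) := by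
  obtain ⟨w, hS⟩ := smul_shortExact (ModuleCat.of R A) r hr
  obtain ⟨h1, ⟨e⟩⟩ := h
  have hinj : ∀ i, ∀ x : Abelian.Ext.{u} (ModuleCat.of R A) Y i, r • x = 0 → x = 0 := by
    intro i x hx
    by_cases hi : i = k
    · subst hi
      apply e.injective
      rw [map_zero]
      apply hr
      simp only
      rw [← map_smul, hx, map_zero, smul_zero]
    · have := h1 i hi
      exact Subsingleton.elim _ _
  refine ⟨fun i hi => ?_, ?_⟩
  · cases i with
    | zero => exact ext_quot_zero_subsingleton hS Y (hinj 0)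
    | succ i =>
      have := h1 i (by omega)
      exact ext_quot_succ_subsingleton hS Y i (fun x => ⟨0, Subsingleton.elim _ _⟩) (hinj _)
  · have := h1 (k + 1) (by omega)
    obtain ⟨f⟩ := ext_quot_equiv hS Y k
    exact ⟨f.trans (QuotSMulTop.congr r e)⟩

open RingTheory.Sequence in
lemma Conc.list {Y : ModuleCat.{u} R} (l : List R) : ∀ {A : Type u} [AddCommGroup A] [Module R A]
    {k : ℕ}, Conc Y A k → IsWeaklyRegular A l →
      Conc Y (A ⧸ (Ideal.ofList l • ⊤ : Submodule R A)) (k + l.length) := by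
  induction l with
  | nil =>
    intro A _ _ k h _
    refine h.congr (Submodule.quotEquivOfEqBot _ ?_).symm
    simp
  | cons x l ih =>
    intro A _ _ k h hl
    rw [isWeaklyRegular_cons_iff] at hl
    have := ih (h.quot hl.1) hl.2
    rw [List.length_cons, add_comm l.length 1, ← add_assoc]
    exact this.congr (Submodule.quotOfListConsSMulTopEquivQuotSMulTopInner A x l).symm

lemma Conc.self : Conc (ModuleCat.of R R) R 0 := by
  refine ⟨fun i hi => ?_, ?_⟩
  · obtain ⟨i, rfl⟩ := Nat.exists_eq_succ_of_ne_zero hi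
    have : Projective (ModuleCat.of R R) := inferInstance
    exact subsingleton_of_forall_eq 0 fun x => eq_zero_of_projective x
  · exact ⟨(Abelian.Ext.linearEquiv₀ (R := R)).trans (ModuleCat.homLinearEquiv (S := R) |>.trans
      (LinearMap.ringLmapEquivSelf R R R))⟩

lemma Conc.residue {S : Type u} [CommRing S] [IsNoetherianRing S] [IsLocalRing S]
    (n : ℕ) (hdim : ringKrullDim S = n)
    (hreg : ∃ s : Finset S, s.card = n ∧ Ideal.span (s : Set S) = maximalIdeal S) :
    Conc (ModuleCat.of S S) (ResidueField S) n := by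
  obtain ⟨s, hs, hm⟩ := hreg
  have hl : Ideal.ofList s.toList = maximalIdeal S := by
    rw [← hm]; simp [Ideal.ofList]
  have h := (regular_list n s.toList (by simpa using hs) hl hdim).2
  have := Conc.list s.toList Conc.self h
  rw [Finset.length_toList, hs, zero_add] at this
  exact this.congr (Submodule.quotEquivOfEq _ (maximalIdeal S) (by rw [hl]; simp))

end ExtBasics
end LyuAux

namespace LyuAux
universe u
section Ischebeck
open Abelian.Ext
open scoped Pointwise

lemma ext_subsingleton_of_subsingleton_left {R : Type u} [CommRing R] (X Y : ModuleCat.{u} R)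
    [Subsingleton X] (n : ℕ) : Subsingleton (Abelian.Ext.{u} X Y n) := by
  refine subsingleton_of_forall_eq 0 fun x => ?_
  have h : 𝟙 X = 0 := by ext y; exact Subsingleton.elim _ _
  rw [← x.mk₀_id_comp, h]
  simp

lemma shortExact_of_linear {R : Type u} [CommRing R] {A B C : Type u} [AddCommGroup A] [Module R A]
    [AddCommGroup B] [Module R B] [AddCommGroup C] [Module R C] (f : A →ₗ[R] B) (g : B →ₗ[R] C)
    (hf : Function.Injective f) (hg : Function.Surjective g) (hfg : Function.Exact f g) :
    (ShortComplex.mk (ModuleCat.ofHom f) (ModuleCat.ofHom g)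
      (by ext x; exact hfg.apply_apply_eq_zero x)).ShortExact :=
  ModuleCat.shortComplex_shortExact _ hfg hf hg

lemma ischebeck {S : Type u} [CommRing S] [IsNoetherianRing S] [IsLocalRing S] (n : ℕ)
    (hS : Conc (ModuleCat.of S S) (ResidueField S) n) (k : ℕ) :
    ∀ (N : Type u) [AddCommGroup N] [Module S N], Module.Finite S N → ∀ i : ℕ,
      Module.supportDim S N ≤ k → i + k < n →
      Subsingleton (Abelian.Ext.{u} (ModuleCat.of S N) (ModuleCat.of S S) i) := by
  induction k using Nat.strong_induction_on with
  | h k ih =>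
  intro N _ _ hN
  refine IsNoetherianRing.induction_on_isQuotientEquivQuotientPrime S hN
    (motive := fun N _ _ _ => ∀ i : ℕ,
      Module.supportDim S N ≤ k → i + k < n →
      Subsingleton (Abelian.Ext.{u} (ModuleCat.of S N) (ModuleCat.of S S) i)) ?_ ?_ ?_
  · intro N _ _ _ _ i _ _
    exact ext_subsingleton_of_subsingleton_left _ _ i
  · intro N _ _ _ p e i hd hik
    by_cases hp : p.asIdeal = maximalIdeal S
    · have e' : N ≃ₗ[S] ResidueField S := e.trans (Submodule.quotEquivOfEq _ _ hp)
      have := hS.1 i (by omega)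
      exact (extCongrLeft e'.toModuleIso _ i).toEquiv.subsingleton
    · have hlt : ¬ maximalIdeal S ≤ p.asIdeal := fun h =>
        hp (le_antisymm (IsLocalRing.le_maximalIdeal p.isPrime.ne_top) h)
      obtain ⟨x, hxm, hxp⟩ := SetLike.not_le_iff_exists.mp hlt
      have hreg' : IsSMulRegular (S ⧸ p.asIdeal) x := by
        intro a b hab
        obtain ⟨a, rfl⟩ := Ideal.Quotient.mk_surjective a
        obtain ⟨b, rfl⟩ := Ideal.Quotient.mk_surjective b
        have h1 : Ideal.Quotient.mk p.asIdeal (x * a) = Ideal.Quotient.mk p.asIdeal (x * b) := hab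
        rw [Ideal.Quotient.eq, ← mul_sub] at h1
        exact Ideal.Quotient.eq.mpr ((p.isPrime.mem_or_mem h1).resolve_left hxp)
      have hreg : IsSMulRegular N x := (e.isSMulRegular_congr x).mpr hreg'
      have hdQ := Module.supportDim_quotSMulTop_succ_eq_supportDim hreg hxm
      obtain ⟨w, hSE⟩ := smul_shortExact (ModuleCat.of S N) x hreg
      have hQ : Subsingleton (Abelian.Ext.{u} (ModuleCat.of S (QuotSMulTop x N))
          (ModuleCat.of S S) (i + 1)) := by
        rw [← hdQ] at hd
        cases k with
        | zero =>
          have : Subsingleton (QuotSMulTop x N) := by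
            rw [← Module.supportDim_eq_bot_iff_subsingleton (R := S)]
            by_contra hne
            have hnt := Module.supportDim_ne_bot_iff_nontrivial (R := S) (M := QuotSMulTop x N) |>.mp hne
            revert hd hne
            generalize Module.supportDim S (QuotSMulTop x N) = z
            intro hd hne
            induction z with
            | bot => exact hne rfl
            | coe z =>
              norm_cast at hd
              simp at hd
          exact ext_subsingleton_of_subsingleton_left _ _ _
        | succ k =>
          refine ih k (by omega) (QuotSMulTop x N) inferInstance (i + 1) ?_ (by omega)
          revert hd
          generalize Module.supportDim S (QuotSMulTop x N) = z
          intro hd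
          induction z with
          | bot => exact bot_le
          | coe z =>
            norm_cast at hd ⊢
            push_cast at hd
            exact (ENat.add_le_add_iff_right (by simp)).mp hd
      have hsurj := smul_surj_of_quot_subsingleton hSE (ModuleCat.of S S) i
      have hfin : Module.Finite S (Abelian.Ext.{u} (ModuleCat.of S N) (ModuleCat.of S S) i) :=
        ModuleCat.finite_ext _ _ _ _
      have htop : (⊤ : Submodule S (Abelian.Ext.{u} (ModuleCat.of S N) (ModuleCat.of S S) i)) = ⊥ := by
        refine Submodule.eq_bot_of_le_smul_of_le_jacobson_bot (maximalIdeal S) _ hfin.fg_top ?_ ?_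
        · intro z _
          obtain ⟨y, rfl⟩ := hsurj z
          exact Submodule.smul_mem_smul hxm trivial
        · rw [IsLocalRing.jacobson_eq_maximalIdeal ⊥ bot_ne_top]
      exact (Submodule.subsingleton_iff S).mp (subsingleton_of_bot_eq_top htop.symm)
  · intro N₁ _ _ _ N₂ _ _ _ N₃ _ _ _ f g hf hg hfg h1 h3 i hd hik
    have hs1 := h1 i ((Module.supportDim_le_of_injective f hf).trans hd) hik
    have hs3 := h3 i ((Module.supportDim_le_of_surjective g hg).trans hd) hik
    have hSE := shortExact_of_linear f g hf hg hfg
    refine subsingleton_of_forall_eq 0 fun z => ?_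
    obtain ⟨y, hy⟩ := contravariant_sequence_exact₂ hSE (ModuleCat.of S S) z
      (Subsingleton.elim (α := Abelian.Ext.{u} (ModuleCat.of S N₁) (ModuleCat.of S S) i) _ _)
    rw [← hy]
    have : y = 0 := Subsingleton.elim (α := Abelian.Ext.{u} (ModuleCat.of S N₃) (ModuleCat.of S S) i) _ _
    rw [this, comp_zero]

end Ischebeck

section Dims

/-- `ht I + dim S/I ≤ dim S` -/
lemma height_add_dim_le {S : Type*} [CommRing S] (n : ℕ) (hdim : ringKrullDim S = n)
    (I : Ideal S) (d : ℕ) (hd : ringKrullDim (S ⧸ I) = d)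
    (c : ℕ)
    (hc : (c : ℕ∞) = ⨅ (P : PrimeSpectrum S) (_ : I ≤ P.asIdeal), Order.height P) : c + d ≤ n := by
  rw [ringKrullDim_quotient] at hd
  obtain ⟨p, hp⟩ := Order.le_krullDim_iff.mp hd.ge
  have h1 : (c : ℕ∞) ≤ Order.height p.head.1 := by
    rw [hc]
    exact iInf₂_le (f := fun (P : PrimeSpectrum S) (_ : I ≤ P.asIdeal) => Order.height P) _ ((PrimeSpectrum.mem_zeroLocus _ _).mp p.head.2)
  obtain ⟨q, hq, hq'⟩ := Order.exists_series_of_le_height p.head.1 h1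
  let p' : LTSeries (PrimeSpectrum S) := p.map Subtype.val (fun _ _ h => h)
  have h2 : q.last = p'.head := hq
  have : ((c + d : ℕ) : WithBot ℕ∞) ≤ ringKrullDim S :=
    Order.le_krullDim_iff.mpr ⟨q.smash p' h2, by rw [RelSeries.smash_length, hq']; exact congrArg _ hp⟩
  rw [hdim] at this
  exact_mod_cast this

lemma supportDim_quot_pow_le {S : Type*} [CommRing S] [IsNoetherianRing S]
    (I : Ideal S) (d : ℕ) (hd : ringKrullDim (S ⧸ I) = d) (t : ℕ) :
    Module.supportDim S (S ⧸ I ^ t) ≤ d := by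
  rw [Module.supportDim_quotient_eq_ringKrullDim, ← hd, ringKrullDim_quotient, ringKrullDim_quotient]
  refine Order.krullDim_le_of_strictMono (fun x => ⟨x.1, ?_⟩) (fun _ _ h => h)
  have := x.2
  rw [PrimeSpectrum.mem_zeroLocus] at this ⊢
  exact x.1.isPrime.le_of_pow_le this

end Dims
end LyuAux

namespace LyuAux
universe u
section Torsion

variable {R : Type u} [CommRing R] (I : Ideal R)

/-- The `I`-power torsion submodule. -/
def gam (M : Type*) [AddCommGroup M] [Module R M] : Submodule R M where
  carrier := {m | ∃ t : ℕ, ∀ a ∈ I ^ t, a • m = 0}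
  add_mem' := by
    rintro x y ⟨s, hs⟩ ⟨t, ht⟩
    refine ⟨max s t, fun a ha => ?_⟩
    rw [smul_add, hs a (Ideal.pow_le_pow_right (le_max_left s t) ha),
      ht a (Ideal.pow_le_pow_right (le_max_right s t) ha), add_zero]
  zero_mem' := ⟨0, fun a _ => smul_zero a⟩
  smul_mem' := by
    rintro c x ⟨s, hs⟩
    exact ⟨s, fun a ha => by rw [smul_comm, hs a ha, smul_zero]⟩

lemma mem_gam {M : Type*} [AddCommGroup M] [Module R M] {m : M} :
    m ∈ gam I M ↔ ∃ t : ℕ, ∀ a ∈ I ^ t, a • m = 0 := Iff.rfl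

variable {I}

lemma gam_map {M N : Type*} [AddCommGroup M] [Module R M] [AddCommGroup N] [Module R N]
    (f : M →ₗ[R] N) {m : M} (hm : m ∈ gam I M) : f m ∈ gam I N := by
  obtain ⟨t, ht⟩ := hm
  exact ⟨t, fun a ha => by rw [← map_smul, ht a ha, map_zero]⟩

lemma gam_of_map {M N : Type*} [AddCommGroup M] [Module R M] [AddCommGroup N] [Module R N]
    (f : M →ₗ[R] N) (hf : Function.Injective f) {m : M} (hm : f m ∈ gam I N) : m ∈ gam I M := by
  obtain ⟨t, ht⟩ := hm
  exact ⟨t, fun a ha => hf (by rw [map_smul, ht a ha, map_zero])⟩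

lemma smul_key {J : Ideal R} {M : Type u} [AddCommGroup M] [Module R M] {N : Submodule R M}
    (f : J →ₗ[R] N) (A : Ideal R) (ht : ∀ j : J, ∀ a ∈ A, a • (f j : M) = 0) (x : R)
    (hx : x ∈ A • (J : Submodule R R)) : ∀ hx : x ∈ J, f ⟨x, hx⟩ = 0 := by
  suffices h : ∃ hx : x ∈ J, f ⟨x, hx⟩ = 0 from fun _ => h.2
  refine Submodule.smul_induction_on (p := fun x => ∃ hx : x ∈ J, f ⟨x, hx⟩ = 0) hx ?_ ?_
  · intro a ha b hb
    refine ⟨J.mul_mem_left a hb, ?_⟩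
    have : (⟨a • b, J.mul_mem_left a hb⟩ : J) = a • (⟨b, hb⟩ : J) := rfl
    rw [this, map_smul]
    exact Subtype.ext (ht ⟨b, hb⟩ a ha)
  · rintro x y ⟨hx, h1⟩ ⟨hy, h2⟩
    refine ⟨J.add_mem hx hy, ?_⟩
    have : (⟨x + y, J.add_mem hx hy⟩ : J) = ⟨x, hx⟩ + ⟨y, hy⟩ := rfl
    rw [this, map_add, h1, h2, add_zero]

variable (I) in
/-- Torsion submodule of an injective module is injective (Noetherian case). -/
lemma gam_injective [IsNoetherianRing R] (E : Type u) [AddCommGroup E] [Module R E]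
    [Module.Injective R E] : Module.Injective R (gam I E) := by
  apply Module.Baer.injective
  intro J f
  -- uniform exponent
  obtain ⟨t, ht⟩ : ∃ t : ℕ, ∀ j : J, ∀ a ∈ I ^ t, a • (f j : E) = 0 := by
    obtain ⟨s, hs⟩ : (⊤ : Submodule R J).FG := IsNoetherian.noetherian _
    choose e he using fun j : J => (f j).2
    refine ⟨s.sup e, fun j a ha => ?_⟩
    have hj : j ∈ Submodule.span R (s : Set J) := hs ▸ trivial
    induction hj using Submodule.span_induction with
    | mem x hx => exact he x a (Ideal.pow_le_pow_right (Finset.le_sup hx) ha)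
    | zero => simp
    | add x y _ _ hx hy => simp [hx, hy]
    | smul c x _ hx => rw [map_smul, Submodule.coe_smul, smul_comm, hx, smul_zero]
  obtain ⟨k, hk⟩ := Ideal.exists_pow_inf_eq_pow_smul I (J : Submodule R R)
  have hk' := hk (k + t) (by omega)
  have hker : ∀ j : J, (j : R) ∈ I ^ (k + t) → f j = 0 := by
    intro j hj
    have hmem : (j : R) ∈ I ^ t • (J : Submodule R R) := by
      have h1 : (j : R) ∈ (I ^ (k + t) • ⊤ ⊓ J : Submodule R R) := ⟨by simpa using hj, j.2⟩
      rw [hk'] at h1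
      have h2 : k + t - k = t := by omega
      rw [h2] at h1
      exact (Submodule.smul_mono le_rfl inf_le_right : _ ≤ I ^ t • (J : Submodule R R)) h1
    have key := smul_key f (I ^ t) ht
    exact key _ hmem j.2
  let φ : J →ₗ[R] R ⧸ (I ^ (k + t)) := (Submodule.mkQ (I ^ (k + t))).comp (Submodule.subtype J)
  have hφ : LinearMap.ker φ ≤ LinearMap.ker ((gam I E).subtype.comp f) := by
    intro j hj
    have : (j : R) ∈ I ^ (k + t) := by
      exact Ideal.Quotient.eq_zero_iff_mem.mp (by simpa [φ] using hj)
    simp [hker j this]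
  obtain ⟨h, hh⟩ := Module.Injective.out ((LinearMap.ker φ).liftQ φ le_rfl)
    (LinearMap.ker_eq_bot.mp (Submodule.ker_liftQ_eq_bot' _ _ rfl))
    ((LinearMap.ker φ).liftQ ((gam I E).subtype.comp f) hφ)
  refine ⟨LinearMap.codRestrict (gam I E) (h.comp (Submodule.mkQ (I ^ (k + t)))) ?_, ?_⟩
  · intro x
    refine ⟨k + t, fun a ha => ?_⟩
    rw [LinearMap.comp_apply, ← map_smul, ← map_smul]
    have : Submodule.mkQ (I ^ (k + t)) (a • x) = 0 := by
      simp only [Submodule.mkQ_apply, Submodule.Quotient.mk_eq_zero]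
      exact Ideal.mul_mem_right _ _ ha
    rw [this, map_zero]
  · intro x hx
    exact Subtype.ext (hh (Submodule.Quotient.mk ⟨x, hx⟩))

lemma exists_inj (M : Type u) [AddCommGroup M] [Module R M] :
    ∃ (E : Type u) (_ : AddCommGroup E) (_ : Module R E) (_ : Module.Injective R E)
      (ι : M →ₗ[R] E), Function.Injective ι := by
  let E : ModuleCat.{u} R := CategoryTheory.Injective.under (ModuleCat.of R M)
  have hE : CategoryTheory.Injective (ModuleCat.of R E) :=
    inferInstanceAs (CategoryTheory.Injective (CategoryTheory.Injective.under (ModuleCat.of R M)))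
  refine ⟨E, inferInstance, inferInstance,
    Module.injective_module_of_injective_object R E,
    (CategoryTheory.Injective.ι (ModuleCat.of R M)).hom, ?_⟩
  exact (ModuleCat.mono_iff_injective _).mp inferInstance

variable (I) in
lemma exists_inj_torsionfree [IsNoetherianRing R] (M : Type u) [AddCommGroup M] [Module R M]
    (hM : gam I M = ⊥) :
    ∃ (E : Type u) (_ : AddCommGroup E) (_ : Module R E) (_ : Module.Injective R E)
      (ι : M →ₗ[R] E), Function.Injective ι ∧ gam I E = ⊥ := by
  obtain ⟨E, _, _, _, ι, hι⟩ := exists_inj (R := R) M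
  have := gam_injective I E
  obtain ⟨r, hr⟩ := Module.Injective.out (gam I E).subtype (Submodule.subtype_injective _)
    (LinearMap.id (R := R) (M := gam I E))
  let π : E →ₗ[R] LinearMap.ker r := LinearMap.codRestrict _ (LinearMap.id - (gam I E).subtype.comp r)
    (by
      intro x
      have := hr (r x)
      simp only [LinearMap.mem_ker, LinearMap.sub_apply, LinearMap.id_apply, map_sub,
        LinearMap.comp_apply] at this ⊢
      rw [this, sub_self])
  have hπ : ∀ x : LinearMap.ker r, π x = x := by
    intro x
    apply Subtype.ext
    have : r x = 0 := x.2
    simp [π, this]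
  refine ⟨LinearMap.ker r, inferInstance, inferInstance, ?_, π.comp ι, ?_, ?_⟩
  · constructor
    intro X Y _ _ _ _ f hf g
    obtain ⟨h, hh⟩ := Module.Injective.out f hf ((LinearMap.ker r).subtype.comp g)
    exact ⟨π.comp h, fun x => by rw [LinearMap.comp_apply, hh]; exact hπ _⟩
  · rw [injective_iff_map_eq_zero]
    intro m hm
    have h1 : ι m - (r (ι m) : E) = 0 := congrArg Subtype.val hm
    have h2 : ι m ∈ gam I E := by
      rw [sub_eq_zero.mp h1]; exact (r (ι m)).2
    have := gam_of_map ι hι h2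
    rw [hM] at this
    simpa using this
  · rw [eq_bot_iff]
    intro x hx
    have h1 := gam_map (LinearMap.ker r).subtype hx
    have h2 := hr ⟨x, h1⟩
    have h3 : r x = 0 := x.2
    have h4 : (⟨(x : E), h1⟩ : gam I E) = 0 := h2.symm.trans h3
    rw [Submodule.mem_bot]
    exact Subtype.ext (show (x : E) = 0 from congrArg (fun z : gam I E => (z : E)) h4)

end Torsion
end LyuAux

namespace LyuAux
section LocCoh
open Abelian.Ext Limits

variable {R : Type} [CommRing R] (I : Ideal R)

/-- Contravariant Ext functor (as modules) in the first variable. -/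
noncomputable def extFun (M : ModuleCat.{0} R) (j : ℕ) : (ModuleCat.{0} R)ᵒᵖ ⥤ ModuleCat.{0} R where
  obj X := ModuleCat.of R (Abelian.Ext.{0} X.unop M j)
  map f := preHom M j f.unop
  map_id X := by
    ext x
    exact mk₀_id_comp x
  map_comp f g := by
    ext x
    exact (mk₀_comp_mk₀_assoc g.unop f.unop x).symm

/-- The diagram of quotients by powers. -/
noncomputable abbrev powD : ℕᵒᵖ ⥤ ModuleCat.{0} R :=
  localCohomology.ringModIdeals (localCohomology.idealPowersDiagram I)

/-- The diagram computing local cohomology, with the derived category version of Ext. -/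
noncomputable abbrev G (j : ℕ) (M : ModuleCat.{0} R) : (ℕᵒᵖ)ᵒᵖ ⥤ ModuleCat.{0} R :=
  (powD I).op ⋙ extFun M j

noncomputable def diagIso (j : ℕ) (M : ModuleCat.{0} R) :
    localCohomology.diagram (localCohomology.idealPowersDiagram I) j ⋙
      (evaluation (ModuleCat.{0} R) (ModuleCat.{0} R)).obj M ≅ G I j M :=
  NatIso.ofComponents (fun t => extIso ((powD I).obj t.unop) M j)
    (fun f => extIso_naturality ((powD I).map f.unop) M j)

/-- Local cohomology as a colimit of modules. -/
noncomputable def lcIso (j : ℕ) (M : ModuleCat.{0} R) :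
    (localCohomology I j).obj M ≅ colimit (G I j M) :=
  colimitObjIsoColimitCompEvaluation
    (localCohomology.diagram (localCohomology.idealPowersDiagram I) j) M ≪≫
    HasColimit.isoOfNatIso (diagIso I j M)

variable {I} in
lemma colim_subsingleton {j : ℕ} {M : ModuleCat.{0} R}
    (h : ∀ t : ℕ, Subsingleton (Abelian.Ext.{0} (ModuleCat.of R (R ⧸ I ^ t)) M j)) :
    Subsingleton (colimit (G I j M) :) := by
  refine subsingleton_of_forall_eq 0 fun x => ?_
  obtain ⟨t, y, rfl⟩ := Concrete.colimit_exists_rep (G I j M) x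
  have : y = 0 := (h t.unop.unop).elim y 0
  rw [this, map_zero]

/-- The connecting map. -/
noncomputable def deltaNat {T : ShortComplex (ModuleCat.{0} R)} (hT : T.ShortExact) (j : ℕ) :
    extFun T.X₃ j ⟶ extFun T.X₁ (j + 1) where
  app X := ModuleCat.ofHom (hT.extClass.postcompOfLinear R X.unop rfl)
  naturality X Y f := by
    ext x
    exact Abelian.Ext.comp_assoc (mk₀ f.unop) _ hT.extClass (zero_add j) rfl (by omega)

lemma delta_bijective {T : ShortComplex (ModuleCat.{0} R)} (hT : T.ShortExact) (j : ℕ)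
    (X : ModuleCat.{0} R) (h1 : Subsingleton (Abelian.Ext.{0} X T.X₂ j))
    (h2 : Subsingleton (Abelian.Ext.{0} X T.X₂ (j + 1))) :
    Function.Bijective (hT.extClass.postcompOfLinear R X (a := j) (b := j + 1) rfl) := by
  constructor
  · rw [injective_iff_map_eq_zero]
    intro x hx
    obtain ⟨y, rfl⟩ := covariant_sequence_exact₃ X hT x rfl hx
    rw [h1.elim y 0, Abelian.Ext.zero_comp]
  · intro x
    obtain ⟨y, hy⟩ := covariant_sequence_exact₁ X hT x (h2.elim _ _) rfl
    exact ⟨y, hy⟩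

lemma colim_shift {T : ShortComplex (ModuleCat.{0} R)} (hT : T.ShortExact) (j : ℕ)
    (h1 : ∀ t : ℕ, Subsingleton (Abelian.Ext.{0} (ModuleCat.of R (R ⧸ I ^ t)) T.X₂ j))
    (h2 : ∀ t : ℕ, Subsingleton (Abelian.Ext.{0} (ModuleCat.of R (R ⧸ I ^ t)) T.X₂ (j + 1))) :
    Nonempty (colimit (G I j T.X₃) ≅ colimit (G I (j + 1) T.X₁)) := by
  let α : G I j T.X₃ ⟶ G I (j + 1) T.X₁ := Functor.whiskerLeft (powD I).op (deltaNat hT j)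
  have : ∀ t, IsIso (α.app t) := by
    intro t
    have hb := delta_bijective hT j ((powD I).obj t.unop) (h1 t.unop.unop) (h2 t.unop.unop)
    exact (ConcreteCategory.isIso_iff_bijective _).mpr hb
  have : IsIso α := NatIso.isIso_of_isIso_app α
  exact ⟨HasColimit.isoOfNatIso (asIso α)⟩

/-- Evaluation at one of a homomorphism out of a cyclic module. -/
noncomputable def evalOne (M : ModuleCat.{0} R) (t : ℕ) :
    Abelian.Ext.{0} (ModuleCat.of R (R ⧸ I ^ t)) M 0 →ₗ[R] M where
  toFun x := (homEquiv₀ x).hom (Submodule.Quotient.mk 1)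
  map_add' x y := by
    change (addEquiv₀ (x + y)).hom _ = (addEquiv₀ x).hom _ + (addEquiv₀ y).hom _
    rw [map_add]; rfl
  map_smul' r x := by
    change (linearEquiv₀ (R := R) (r • x)).hom _ = r • (linearEquiv₀ (R := R) x).hom _
    rw [map_smul]; rfl

lemma evalOne_mk₀ (M : ModuleCat.{0} R) (t : ℕ) (f : ModuleCat.of R (R ⧸ I ^ t) ⟶ M) :
    evalOne I M t (mk₀ f) = f.hom (Submodule.Quotient.mk 1) := by
  have : homEquiv₀ (mk₀ f) = f := homEquiv₀.right_inv f
  change (homEquiv₀ (mk₀ f)).hom _ = _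
  rw [this]

lemma evalOne_mem (M : ModuleCat.{0} R) (t : ℕ)
    (x : Abelian.Ext.{0} (ModuleCat.of R (R ⧸ I ^ t)) M 0) : evalOne I M t x ∈ gam I M := by
  obtain ⟨f, rfl⟩ := (mk₀_bijective _ _).2 x
  rw [evalOne_mk₀]
  refine ⟨t, fun a ha => ?_⟩
  rw [← map_smul]
  have : (a • Submodule.Quotient.mk 1 : R ⧸ I ^ t) = 0 := by
    rw [← Submodule.Quotient.mk_smul, Submodule.Quotient.mk_eq_zero]
    rw [smul_eq_mul, mul_one]; exact ha
  exact (congrArg f.hom this).trans (map_zero f.hom)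

lemma evalOne_injective (M : ModuleCat.{0} R) (t : ℕ) : Function.Injective (evalOne I M t) := by
  rw [injective_iff_map_eq_zero]
  intro x hx
  obtain ⟨f, rfl⟩ := (mk₀_bijective _ _).2 x
  rw [evalOne_mk₀] at hx
  rw [mk₀_eq_zero_iff]
  refine ModuleCat.hom_ext (LinearMap.ext fun y => ?_)
  obtain ⟨r, rfl⟩ := Submodule.Quotient.mk_surjective _ y
  have : (Submodule.Quotient.mk r : R ⧸ I ^ t) = r • Submodule.Quotient.mk 1 := by
    rw [← Submodule.Quotient.mk_smul]; simp
  refine (congrArg f.hom this).trans ?_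
  refine (map_smul f.hom r _).trans ?_
  rw [hx, smul_zero]; rfl

lemma evalOne_surj (M : ModuleCat.{0} R) (m : M) (t : ℕ) (hm : ∀ a ∈ I ^ t, a • m = 0) :
    ∃ x, evalOne I M t x = m := by
  refine ⟨mk₀ (ModuleCat.ofHom ((I ^ t).liftQ (LinearMap.toSpanSingleton R M m) ?_)), ?_⟩
  · intro a ha
    exact hm a ha
  · rw [evalOne_mk₀]
    exact one_smul R m

lemma evalOne_pre (M : ModuleCat.{0} R) {s t : (ℕᵒᵖ)ᵒᵖ} (h : s ⟶ t)
    (x : Abelian.Ext.{0} (ModuleCat.of R (R ⧸ I ^ s.unop.unop)) M 0) :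
    evalOne I M t.unop.unop ((G I 0 M).map h x) = evalOne I M s.unop.unop x := by
  obtain ⟨f, rfl⟩ := (mk₀_bijective _ _).2 x
  have : (G I 0 M).map h (mk₀ f) = mk₀ ((powD I).map h.unop ≫ f) := mk₀_comp_mk₀ _ _
  refine (congrArg _ this).trans ?_
  rw [evalOne_mk₀]
  refine (evalOne_mk₀ I M _ _).trans ?_
  rfl

/-- The cocone giving the torsion submodule. -/
noncomputable def gamCocone (M : ModuleCat.{0} R) : Cocone (G I 0 M) where
  pt := ModuleCat.of R (gam I M)
  ι :=
    { app := fun t => ModuleCat.ofHom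
        (LinearMap.codRestrict (gam I M) (evalOne I M t.unop.unop) (evalOne_mem I M _))
      naturality := fun s t h => by
        ext x
        exact Subtype.ext (evalOne_pre I M h x) }

lemma gamIso (M : ModuleCat.{0} R) : Nonempty (colimit (G I 0 M) ≅ ModuleCat.of R (gam I M)) := by
  let φ : colimit (G I 0 M) ⟶ ModuleCat.of R (gam I M) :=
    colimit.desc (G I 0 M) (gamCocone I M)
  have hφ : ∀ t y, φ (colimit.ι (G I 0 M) t y) = (gamCocone I M).ι.app t y := fun t y =>
    ConcreteCategory.congr_hom (colimit.ι_desc (gamCocone I M) t) y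
  have : IsIso φ := by
    rw [ConcreteCategory.isIso_iff_bijective]
    constructor
    · refine (injective_iff_map_eq_zero φ.hom).mpr ?_
      intro x hx
      obtain ⟨t, y, rfl⟩ := Concrete.colimit_exists_rep (G I 0 M) x
      have h1 : (gamCocone I M).ι.app t y = 0 := (hφ t y).symm.trans hx
      have h2 : evalOne I M t.unop.unop y = 0 := congrArg (fun z : gam I M => (z : M)) h1
      have h3 : y = 0 := evalOne_injective I M _ (h2.trans (map_zero _).symm)
      rw [h3, map_zero]
    · rintro ⟨m, t, ht⟩
      obtain ⟨x, hx⟩ := evalOne_surj I M m t ht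
      refine ⟨colimit.ι (G I 0 M) (op (op t)) x, ?_⟩
      exact (hφ _ _).trans (Subtype.ext hx)
  exact ⟨asIso φ⟩

lemma gam_surj {T : ShortComplex (ModuleCat.{0} R)} (hT : T.ShortExact)
    (h : Subsingleton (colimit (G I 1 T.X₁) :)) (x : T.X₃) (hx : x ∈ gam I T.X₃) :
    ∃ e ∈ gam I T.X₂, T.g e = x := by
  obtain ⟨t, ht⟩ := hx
  obtain ⟨f, hf⟩ := evalOne_surj I T.X₃ x t ht
  let y : (G I 1 T.X₁).obj (op (op t)) := f.comp hT.extClass rfl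
  have h0 : colimit.ι (G I 1 T.X₁) (op (op t)) y = colimit.ι (G I 1 T.X₁) (op (op t)) 0 :=
    h.elim _ _
  obtain ⟨s, a, b, hab⟩ := Concrete.colimit_exists_of_rep_eq (G I 1 T.X₁) _ _ h0
  rw [map_zero] at hab
  let f' : Abelian.Ext.{0} (ModuleCat.of R (R ⧸ I ^ s.unop.unop)) T.X₃ 0 := (G I 0 T.X₃).map a f
  have h1 : f'.comp hT.extClass rfl = 0 := by
    refine Eq.trans ?_ hab
    exact Abelian.Ext.comp_assoc (mk₀ ((powD I).map a.unop)) f hT.extClass (zero_add 0) rfl (by omega)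
  obtain ⟨e, he⟩ := covariant_sequence_exact₃ _ hT f' rfl h1
  refine ⟨evalOne I _ _ e, evalOne_mem I _ _ _, ?_⟩
  rw [← hf, ← evalOne_pre I T.X₃ a f]
  change _ = evalOne I _ _ f'
  rw [← he]
  obtain ⟨e, rfl⟩ := (mk₀_bijective _ _).2 e
  rw [mk₀_comp_mk₀, evalOne_mk₀, evalOne_mk₀]
  rfl

end LocCoh
end LyuAux

namespace LyuAux
section Core
open Abelian.Ext Limits

variable {R : Type} [CommRing R] (I : Ideal R)

/-- inclusion of the torsion submodule -/
noncomputable abbrev gamIncl (M : ModuleCat.{0} R) : ModuleCat.of R (gam I M) ⟶ M :=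
  ModuleCat.ofHom (gam I M).subtype

/-- map induced on torsion submodules -/
noncomputable abbrev gamMap {M N : ModuleCat.{0} R} (f : M ⟶ N) :
    ModuleCat.of R (gam I M) ⟶ ModuleCat.of R (gam I N) :=
  ModuleCat.ofHom (f.hom.restrict (p := gam I M) (q := gam I N) (fun _ hx => gam_map f.hom hx))

lemma gamMap_incl {M N : ModuleCat.{0} R} (f : M ⟶ N) :
    gamMap I f ≫ gamIncl I N = gamIncl I M ≫ f := rfl

lemma gamMap_zero (T : ShortComplex (ModuleCat.{0} R)) : gamMap I T.f ≫ gamMap I T.g = 0 := by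
  refine ModuleCat.hom_ext (LinearMap.ext fun x => Subtype.ext ?_)
  exact ConcreteCategory.congr_hom T.zero (x : T.X₁)

lemma gam_shortExact {T : ShortComplex (ModuleCat.{0} R)} (hT : T.ShortExact)
    (h : Subsingleton (colimit (G I 1 T.X₁) :)) :
    (ShortComplex.mk (gamMap I T.f) (gamMap I T.g) (gamMap_zero I T)).ShortExact := by
  have hf : Function.Injective T.f := (ModuleCat.mono_iff_injective _).mp hT.mono_f
  refine ModuleCat.shortComplex_shortExact _ ?_ ?_ ?_
  · intro x
    constructor
    · intro hx
      have hx' : T.g (x : T.X₂) = 0 := congrArg (fun z : gam I T.X₃ => (z : T.X₃)) hx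
      have hex := (ShortComplex.ShortExact.moduleCat_exact_iff_function_exact T).mp hT.exact
      obtain ⟨y, hy⟩ := (hex _).mp hx'
      have hyg : T.f.hom y ∈ gam I T.X₂ := by
        have := x.2
        exact hy ▸ this
      exact ⟨⟨y, gam_of_map T.f.hom hf hyg⟩, Subtype.ext hy⟩
    · rintro ⟨y, rfl⟩
      exact Subtype.ext (ConcreteCategory.congr_hom T.zero (y : T.X₁))
  · intro x y hxy
    exact Subtype.ext (hf (congrArg (fun z : gam I T.X₂ => (z : T.X₂)) hxy))
  · rintro ⟨x, hx⟩
    obtain ⟨e, he, rfl⟩ := gam_surj I hT h x hx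
    exact ⟨⟨e, he⟩, rfl⟩

lemma hom_gam_bij (K M : ModuleCat.{0} R) (hK : ∀ a ∈ I, ∀ x : K, a • x = 0) :
    Function.Bijective ((mk₀ (gamIncl I M)).postcompOfLinear R K (add_zero 0)) := by
  constructor
  · rw [injective_iff_map_eq_zero]
    intro x hx
    obtain ⟨f, rfl⟩ := (mk₀_bijective _ _).2 x
    have h1 : mk₀ (f ≫ gamIncl I M) = 0 := (mk₀_comp_mk₀ _ _).symm.trans hx
    rw [mk₀_eq_zero_iff] at h1 ⊢
    refine ModuleCat.hom_ext (LinearMap.ext fun y => ?_)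
    exact Subtype.ext (ConcreteCategory.congr_hom h1 y)
  · intro x
    obtain ⟨f, rfl⟩ := (mk₀_bijective _ _).2 x
    have hmem : ∀ y : K, f.hom y ∈ gam I M := fun y => ⟨1, fun a ha => by
      rw [pow_one] at ha
      rw [← map_smul, hK a ha, map_zero]⟩
    refine ⟨mk₀ (ModuleCat.ofHom (LinearMap.codRestrict (gam I M) f.hom hmem)), ?_⟩
    exact mk₀_comp_mk₀ _ _

lemma exists_ses (M : ModuleCat.{0} R) (E : Type) [AddCommGroup E] [Module R E]
    (ι : M →ₗ[R] E) (hι : Function.Injective ι) :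
    ∃ (N : ModuleCat.{0} R) (g : ModuleCat.of R E ⟶ N) (w : ModuleCat.ofHom ι ≫ g = 0),
      (ShortComplex.mk (ModuleCat.ofHom ι) g w).ShortExact :=
  ⟨_, _, _, shortExact_of_linear ι (LinearMap.range ι).mkQ hι (Submodule.mkQ_surjective _)
    (LinearMap.exact_map_mkQ_range ι)⟩

lemma gam_ext_bij [IsNoetherianRing R] (K : ModuleCat.{0} R) (hK : ∀ a ∈ I, ∀ x : K, a • x = 0)
    (i : ℕ) : ∀ (M : ModuleCat.{0} R), (∀ j ≠ 0, Subsingleton (colimit (G I j M) :)) →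
    Function.Bijective ((mk₀ (gamIncl I M)).postcompOfLinear R K (add_zero i)) := by
  induction i with
  | zero => exact fun M _ => hom_gam_bij I K M hK
  | succ i ih =>
    intro M hM
    obtain ⟨E, _, _, hEinj, ι, hι⟩ := exists_inj (R := R) M
    obtain ⟨N, g, w, hT⟩ := exists_ses M E ι hι
    have hE : CategoryTheory.Injective (ModuleCat.of R E) :=
      Module.injective_object_of_injective_module R E
    have hGE : CategoryTheory.Injective (ModuleCat.of R (gam I (ModuleCat.of R E))) := by
      have := gam_injective I E
      exact Module.injective_object_of_injective_module R (gam I E)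
    have hEs : ∀ (X : ModuleCat.{0} R) (j : ℕ), Subsingleton (Abelian.Ext.{0} X (ModuleCat.of R E) (j + 1)) :=
      fun X j => subsingleton_of_forall_eq 0 fun x => eq_zero_of_injective x
    have hN : ∀ j ≠ 0, Subsingleton (colimit (G I j N) :) := by
      intro j hj
      obtain ⟨j, rfl⟩ := Nat.exists_eq_succ_of_ne_zero hj
      obtain ⟨e⟩ := colim_shift I hT (j + 1) (fun t => hEs _ j) (fun t => hEs _ (j + 1))
      have := hM (j + 1 + 1) (by omega)
      exact e.toLinearEquiv.toEquiv.subsingleton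
    have hEc : ∀ j ≠ 0, Subsingleton (colimit (G I j (ModuleCat.of R E)) :) := by
      intro j hj
      obtain ⟨j, rfl⟩ := Nat.exists_eq_succ_of_ne_zero hj
      exact colim_subsingleton (fun t => hEs _ j)
    have hT' := gam_shortExact I hT (hM 1 one_ne_zero)
    have hnat := ShortComplex.ShortExact.extClass_naturality hT' hT
      { τ₁ := gamIncl I M, τ₂ := gamIncl I (ModuleCat.of R E), τ₃ := gamIncl I N,
        comm₁₂ := rfl, comm₂₃ := rfl }
    have hsq : ∀ y : Abelian.Ext.{0} K (ModuleCat.of R (gam I N)) i,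
        (y.comp (mk₀ (gamIncl I N)) (add_zero i)).comp hT.extClass rfl =
          (y.comp hT'.extClass rfl).comp (mk₀ (gamIncl I M)) (add_zero (i + 1)) := by
      intro y
      have h1 := Abelian.Ext.comp_assoc y (mk₀ (gamIncl I N)) hT.extClass
        (add_zero i) (zero_add 1) (show i + 0 + 1 = i + 1 by omega)
      have h2 := Abelian.Ext.comp_assoc y hT'.extClass (mk₀ (gamIncl I M))
        (a₁₂ := i + 1) rfl (add_zero 1) (show i + 1 + 0 = i + 1 by omega)
      rw [h1, h2]
      exact congrArg (fun z => y.comp z _) hnat.symm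
    constructor
    · rw [injective_iff_map_eq_zero]
      intro x hx
      have hx' : x.comp (mk₀ (gamIncl I M)) (add_zero (i + 1)) = 0 := hx
      obtain ⟨y, rfl⟩ := covariant_sequence_exact₁ K hT' x (eq_zero_of_injective _) rfl
      have h0 := (hsq y).trans hx'
      obtain ⟨z, hz⟩ := covariant_sequence_exact₃ K hT _ rfl h0
      obtain ⟨z', hz'⟩ := (ih _ hEc).2 z
      have h3 : y = z'.comp (mk₀ (gamMap I g)) (add_zero i) := by
        apply (ih N hN).1
        change y.comp (mk₀ (gamIncl I N)) (add_zero i) =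
          (z'.comp (mk₀ (gamMap I g)) (add_zero i)).comp (mk₀ (gamIncl I N)) (add_zero i)
        rw [← hz, ← hz']
        change (z'.comp (mk₀ (gamIncl I (ModuleCat.of R E))) (add_zero i)).comp (mk₀ g) (add_zero i) = _
        rw [comp_assoc_of_second_deg_zero, comp_assoc_of_second_deg_zero, mk₀_comp_mk₀,
          mk₀_comp_mk₀, gamMap_incl]
      rw [h3]
      refine (Abelian.Ext.comp_assoc z' (mk₀ (gamMap I g)) hT'.extClass
        (add_zero i) (zero_add 1) (show i + 0 + 1 = i + 1 by omega)).trans ?_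
      have := hT'.comp_extClass
      refine (congrArg (fun z => z'.comp z _) this).trans ?_
      exact Abelian.Ext.comp_zero z' _ _ (i + 1) rfl
    · intro x
      obtain ⟨y, rfl⟩ := covariant_sequence_exact₁ K hT x (eq_zero_of_injective _) rfl
      obtain ⟨y', rfl⟩ := (ih N hN).2 y
      exact ⟨y'.comp hT'.extClass rfl, (hsq y').symm⟩

lemma core [IsNoetherianRing R] (K : ModuleCat.{0} R) (hK : ∀ a ∈ I, ∀ x : K, a • x = 0)
    (c : ℕ) : ∀ (M : ModuleCat.{0} R), (∀ j ≠ c, Subsingleton (colimit (G I j M) :)) →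
    ∀ i, Nonempty (Abelian.Ext.{0} K (colimit (G I c M)) i ≃ₗ[R] Abelian.Ext.{0} K M (i + c)) := by
  induction c with
  | zero =>
    intro M hM i
    obtain ⟨e⟩ := gamIso I M
    exact ⟨(extCongrRight K e i).trans (LinearEquiv.ofBijective _ (gam_ext_bij I K hK i M hM))⟩
  | succ c ih =>
    intro M hM i
    have hM0 : gam I M = ⊥ := by
      obtain ⟨e⟩ := gamIso I M
      have := hM 0 (by omega)
      have h2 : Subsingleton (gam I M) := e.toLinearEquiv.symm.toEquiv.subsingleton
      exact (Submodule.subsingleton_iff_eq_bot).mp h2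
    obtain ⟨E, _, _, hEinj, ι, hι, hE0⟩ := exists_inj_torsionfree I M hM0
    obtain ⟨N, g, w, hT⟩ := exists_ses M E ι hι
    have hE : CategoryTheory.Injective (ModuleCat.of R E) :=
      Module.injective_object_of_injective_module R E
    have hEs : ∀ (X : ModuleCat.{0} R) (j : ℕ), Subsingleton (Abelian.Ext.{0} X (ModuleCat.of R E) (j + 1)) :=
      fun X j => subsingleton_of_forall_eq 0 fun x => eq_zero_of_injective x
    have hgE : Subsingleton (gam I E) := (Submodule.subsingleton_iff_eq_bot).mpr hE0
    have hE1 : ∀ (t : ℕ) (j : ℕ), Subsingleton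
        (Abelian.Ext.{0} (ModuleCat.of R (R ⧸ I ^ t)) (ModuleCat.of R E) j) := by
      intro t j
      cases j with
      | succ j => exact hEs _ j
      | zero =>
        refine subsingleton_of_forall_eq 0 fun x => evalOne_injective I _ t ?_
        have h1 := evalOne_mem I _ t x
        have h2 := evalOne_mem I _ t (0 : Abelian.Ext.{0} (ModuleCat.of R (R ⧸ I ^ t)) (ModuleCat.of R E) 0)
        exact congrArg (fun z : gam I E => (z : E)) (hgE.elim ⟨_, h1⟩ ⟨_, h2⟩)
    have hE2 : ∀ (j : ℕ), Subsingleton (Abelian.Ext.{0} K (ModuleCat.of R E) j) := by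
      intro j
      cases j with
      | succ j => exact hEs _ j
      | zero =>
        have : Subsingleton (ModuleCat.of R (gam I (ModuleCat.of R E))) := hgE
        have h3 := ext_subsingleton_of_subsingleton_right K (ModuleCat.of R (gam I (ModuleCat.of R E))) 0
        exact (Equiv.ofBijective _ (hom_gam_bij I K (ModuleCat.of R E) hK)).symm.subsingleton
    have hN : ∀ j ≠ c, Subsingleton (colimit (G I j N) :) := by
      intro j hj
      obtain ⟨e⟩ := colim_shift I hT j (fun t => hE1 t j) (fun t => hE1 t (j + 1))
      have := hM (j + 1) (by omega)
      exact e.toLinearEquiv.toEquiv.subsingleton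
    obtain ⟨e⟩ := colim_shift I hT c (fun t => hE1 t c) (fun t => hE1 t (c + 1))
    obtain ⟨f⟩ := ih N hN i
    exact ⟨((extCongrRight K e.symm i).trans f).trans
      (LinearEquiv.ofBijective _ (delta_bijective hT (i + c) K (hE2 _) (hE2 _)))⟩

end Core
end LyuAux

/-- If `(S,𝔪,K)` is an `n`-dimensional regular local ring containing a field and `I ⊆ S`
is a cohomologically complete intersection ideal (i.e. `H^j_I(S) ≠ 0` iff `j = ht I`),
then the Lyubeznik numbers `λ_{i,j}(S/I) = dim_K Ext^i_S(K, H^{n−j}_I(S))` of `R = S/I`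
satisfy `λ_{d,d} = 1` (the Ext module is isomorphic to the residue field) and
`λ_{i,j} = 0` otherwise, where `d = dim S/I`. -/
theorem lyubeznik_table_trivial_of_cohomologically_complete_intersection
    {S : Type} [CommRing S] [IsNoetherianRing S] [IsLocalRing S]
    (F : Type) [Field F] [Algebra F S]
    (n : ℕ) (hdim : ringKrullDim S = n)
    (hreg : ∃ s : Finset S, s.card = n ∧ Ideal.span (s : Set S) = maximalIdeal S)
    (I : Ideal S) (d : ℕ) (hd : ringKrullDim (S ⧸ I) = d)
    (c : ℕ)
    (hc : (c : ℕ∞) = ⨅ (P : PrimeSpectrum S) (_ : I ≤ P.asIdeal), Order.height P)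
    (hCCI : ∀ j : ℕ,
      ¬ Subsingleton ((localCohomology I j).obj (ModuleCat.of S S)) ↔ j = c) :
    Nonempty ((((Ext S (ModuleCat S) d).obj (op (ModuleCat.of S (ResidueField S)))).obj
        ((localCohomology I (n - d)).obj (ModuleCat.of S S))) ≃ₗ[S] ResidueField S) ∧
      ∀ i j : ℕ, j ≤ n → ¬(i = d ∧ j = d) →
        Subsingleton ((((Ext S (ModuleCat S) i).obj
            (op (ModuleCat.of S (ResidueField S)))).obj
          ((localCohomology I (n - j)).obj (ModuleCat.of S S))) : Type) := by
  have hconc := LyuAux.Conc.residue n hdim hreg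
  have hle := LyuAux.height_add_dim_le n hdim I d hd c hc
  have hsub : ∀ j ≠ c, Subsingleton
      ((localCohomology I j).obj (ModuleCat.of S S)) := fun j hj =>
    not_not.mp fun h => hj ((hCCI j).mp h)
  have hcol : ∀ j ≠ c, Subsingleton (Limits.colimit (LyuAux.G I j (ModuleCat.of S S)) :) := by
    intro j hj
    have := hsub j hj
    exact (LyuAux.lcIso I j (ModuleCat.of S S)).toLinearEquiv.symm.toEquiv.subsingleton
  have hge : ¬ (c + d < n) := by
    intro hlt
    refine (hCCI c).mpr rfl ?_
    have := LyuAux.colim_subsingleton (I := I) (j := c) (M := ModuleCat.of S S) fun t =>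
      LyuAux.ischebeck n hconc d (S ⧸ I ^ t) inferInstance c
        (LyuAux.supportDim_quot_pow_le I d hd t) hlt
    exact (LyuAux.lcIso I c (ModuleCat.of S S)).toLinearEquiv.toEquiv.subsingleton
  have hI : I ≠ ⊤ := by
    rintro rfl
    have : Subsingleton (S ⧸ (⊤ : Ideal S)) := Ideal.Quotient.subsingleton_iff.mpr rfl
    rw [ringKrullDim_eq_bot_of_subsingleton] at hd
    exact WithBot.bot_ne_coe hd
  have hIm : I ≤ maximalIdeal S := IsLocalRing.le_maximalIdeal hI
  have hK : ∀ a ∈ I, ∀ x : ModuleCat.of S (ResidueField S), a • x = 0 := by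
    intro a ha x
    change a • (x : ResidueField S) = 0
    rw [Algebra.smul_def]
    have : algebraMap S (ResidueField S) a = 0 :=
      (IsLocalRing.residue_eq_zero_iff a).mpr (hIm ha)
    rw [this, zero_mul]
  have hcore : ∀ i, Nonempty ((((Ext S (ModuleCat S) i).obj
      (op (ModuleCat.of S (ResidueField S)))).obj
        ((localCohomology I c).obj (ModuleCat.of S S))) ≃ₗ[S]
      Abelian.Ext.{0} (ModuleCat.of S (ResidueField S)) (ModuleCat.of S S) (i + c)) := by
    intro i
    obtain ⟨e⟩ := LyuAux.core I (ModuleCat.of S (ResidueField S)) hK c (ModuleCat.of S S) hcol i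
    exact ⟨((LyuAux.extIso _ _ i).toLinearEquiv.trans
      (LyuAux.extCongrRight _ (LyuAux.lcIso I c (ModuleCat.of S S)) i)).trans e⟩
  have hn : n = d + c := by omega
  constructor
  · have h1 : n - d = c := by omega
    rw [h1]
    obtain ⟨e⟩ := hcore d
    obtain ⟨f⟩ := hconc.2
    rw [← hn] at e
    exact ⟨e.trans f⟩
  · intro i j hj hij
    by_cases hjd : j = d
    · have h1 : n - j = c := by omega
      rw [h1]
      obtain ⟨e⟩ := hcore i
      have := hconc.1 (i + c) (by omega)
      exact e.toEquiv.subsingleton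
    · have := hsub (n - j) (by omega)
      have h2 := LyuAux.ext_subsingleton_of_subsingleton_right
        (ModuleCat.of S (ResidueField S)) ((localCohomology I (n - j)).obj (ModuleCat.of S S)) i
      exact (LyuAux.extIso (ModuleCat.of S (ResidueField S))
        ((localCohomology I (n - j)).obj (ModuleCat.of S S)) i).toLinearEquiv.toEquiv.subsingleton
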